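/- Let d ≥ 1, 1 ≤ p ≤ ∞, and let A = (A₁,A₂), B = (B₁,B₂) be pairs with nonnegative entries; if p > 1 assume additionally p′B₂ > d. Set β_{p,∞} = ( max(B₁ + d(1/p − 1), 0), B₂ + d(1/p − 1) ). Then there is a constant c such that for every Schwartz function f on ℝ^d and every t > 0: ‖f‖_∞ ≤ c ( C(t) ‖ ξ^B f̂ ‖_p + t^{−A} ‖ x^A f ‖_∞ ), where t^{−A} = t^{−A₁} for t < 1 and t^{−A₂} for t ≥ 1, and: if B₁ + d(1/p − 1) ≠ 0 then C(t) = t^{β_{p,∞}^T} (i.e. C(t) = t^{B₂ + d(1/p−1)} for t < 1 and C(t) = t^{max(B₁ + d(1/p−1),0)} for t ≥ 1); if B₁ + d(1/p − 1) = 0 then C(t) = t^{β_{p,∞}^T} for t < 1 and C(t) = (log(1+t))^{1/p′} for t ≥ 1. -/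

import Mathlib

open MeasureTheory
open scoped ENNReal FourierTransform

/-- The broken power weight `x^A`: `|x|^{A₁}` for `|x| < 1`, `|x|^{A₂}` for `|x| ≥ 1`. -/
noncomputable def brokenWeight {d : ℕ} (A : ℝ × ℝ) (x : EuclideanSpace ℝ (Fin d)) : ℝ :=
  if ‖x‖ < 1 then ‖x‖ ^ A.1 else ‖x‖ ^ A.2

/-- Broken power of a positive real number `t`: `t^{E₁}` for `t < 1`, `t^{E₂}` for `t ≥ 1`. -/
noncomputable def brokenPow (E : ℝ × ℝ) (t : ℝ) : ℝ :=
  if t < 1 then t ^ E.1 else t ^ E.2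

lemma lintegral_Ioc_rpow_sub_one {a b : ℝ} (ha : 0 < a) (hb : 0 < b) :
    ∫⁻ r in Set.Ioc 0 b, ENNReal.ofReal (r ^ (a - 1)) = ENNReal.ofReal (b ^ a / a) := by
  have hi : IntervalIntegrable (fun r : ℝ => r ^ (a - 1)) volume 0 b :=
    intervalIntegral.intervalIntegrable_rpow' (by linarith)
  rw [← ofReal_integral_eq_lintegral_ofReal ((intervalIntegrable_iff_integrableOn_Ioc_of_le hb.le).1 hi)
    ((ae_restrict_mem measurableSet_Ioc).mono fun r hr => Real.rpow_nonneg hr.1.le _),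
    ← intervalIntegral.integral_of_le hb.le, integral_rpow (Or.inl (by linarith))]
  simp [Real.zero_rpow ha.ne']

lemma lintegral_Ioi_rpow_sub_one {a b : ℝ} (ha : a < 0) (hb : 0 < b) :
    ∫⁻ r in Set.Ioi b, ENNReal.ofReal (r ^ (a - 1)) = ENNReal.ofReal (b ^ a / (-a)) := by
  rw [← ofReal_integral_eq_lintegral_ofReal (integrableOn_Ioi_rpow_of_lt (by linarith) hb)
    ((ae_restrict_mem measurableSet_Ioi).mono fun r hr => Real.rpow_nonneg (hb.le.trans hr.le) _),
    integral_Ioi_rpow_of_lt (by linarith) hb]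
  simp [div_neg, neg_div]

lemma lintegral_Ioc_rpow_neg_one {b : ℝ} (hb : 0 < b) (hb1 : b ≤ 1) :
    ∫⁻ r in Set.Ioc b 1, ENNReal.ofReal (r ^ (-1 : ℝ)) = ENNReal.ofReal (-Real.log b) := by
  have h0 : (0 : ℝ) ∉ Set.uIcc b 1 := by
    rw [Set.uIcc_of_le hb1]; exact fun h => absurd h.1 (not_le.2 hb)
  have hi : IntervalIntegrable (fun r : ℝ => r⁻¹) volume b 1 := by
    simpa using intervalIntegral.intervalIntegrable_inv (μ := volume) (f := fun r : ℝ => r)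
      (fun x hx => by rintro rfl; exact h0 hx) continuousOn_id
  simp only [Real.rpow_neg_one]
  rw [← ofReal_integral_eq_lintegral_ofReal ((intervalIntegrable_iff_integrableOn_Ioc_of_le hb1).1 hi)
    ((ae_restrict_mem measurableSet_Ioc).mono fun r hr => inv_nonneg.2 (hb.le.trans hr.1.le)),
    ← intervalIntegral.integral_of_le hb1, integral_inv h0]
  simp

/-- The part of a truncated power integral below the truncation point `1 / t`. -/
lemma setLIntegral_Ioc_rpow_mul_min_le {a N t b : ℝ} (haN : 0 < a + N) (hN : 0 ≤ N) (ht : 0 < t)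
    (hb : 0 < b) :
    ∫⁻ r in Set.Ioc 0 b, ENNReal.ofReal (r ^ (a - 1) * min 1 (t * r) ^ N) ≤
      ENNReal.ofReal (t ^ N * (b ^ (a + N) / (a + N))) := by
  rw [ENNReal.ofReal_mul (by positivity), ← lintegral_Ioc_rpow_sub_one haN hb,
    ← lintegral_const_mul' _ _ ENNReal.ofReal_ne_top]
  refine setLIntegral_mono' measurableSet_Ioc fun r hr => ?_
  have hr0 : 0 < r := hr.1
  rw [← ENNReal.ofReal_mul (by positivity)]
  refine ENNReal.ofReal_le_ofReal ?_
  calc r ^ (a - 1) * min 1 (t * r) ^ N ≤ r ^ (a - 1) * (t * r) ^ N := by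
        gcongr; exact min_le_right _ _
    _ = t ^ N * r ^ (a + N - 1) := by
        rw [Real.mul_rpow ht.le hr0.le, show a + N - 1 = (a - 1) + N by ring, Real.rpow_add hr0]
        ring

lemma setLIntegral_rpow_mul_min_le {a N t : ℝ} (hN : 0 ≤ N) (ht : 0 < t)
    {s : Set ℝ} (hs : MeasurableSet s) (hs0 : s ⊆ Set.Ioi 0) :
    ∫⁻ r in s, ENNReal.ofReal (r ^ (a - 1) * min 1 (t * r) ^ N) ≤
      ∫⁻ r in s, ENNReal.ofReal (r ^ (a - 1)) := by
  refine setLIntegral_mono' hs fun r hr => ?_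
  have hr0 : 0 < r := hs0 hr
  refine ENNReal.ofReal_le_ofReal (mul_le_of_le_one_right (by positivity) ?_)
  exact Real.rpow_le_one (by positivity) (min_le_left _ _) hN

lemma lintegral_Ioi_rpow_mul_min_le {a N t : ℝ} (ha : a < 0) (haN : 0 < a + N) (ht : 0 < t) :
    ∫⁻ r in Set.Ioi 0, ENNReal.ofReal (r ^ (a - 1) * min 1 (t * r) ^ N) ≤
      ENNReal.ofReal ((1 / (a + N) + 1 / (-a)) * t ^ (-a)) := by
  have hN : 0 ≤ N := by linarith
  have hit : 0 < t⁻¹ := by positivity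
  rw [← Set.Ioc_union_Ioi_eq_Ioi hit.le]
  refine (lintegral_union_le _ _ _).trans ?_
  refine (add_le_add (setLIntegral_Ioc_rpow_mul_min_le haN hN ht hit)
    ((setLIntegral_rpow_mul_min_le hN ht measurableSet_Ioi (Set.Ioi_subset_Ioi hit.le)).trans
      (lintegral_Ioi_rpow_sub_one ha hit).le)).trans ?_
  have ha' : 0 < -a := by linarith
  rw [← ENNReal.ofReal_add (by positivity) (by positivity)]
  refine ENNReal.ofReal_le_ofReal (le_of_eq ?_)
  rw [Real.inv_rpow ht.le, Real.inv_rpow ht.le, ← Real.rpow_neg ht.le, ← Real.rpow_neg ht.le,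
    mul_div_assoc', ← Real.rpow_add ht, show N + -(a + N) = -a by ring]
  ring

/-- Growth in `t` of the radial integral of a broken power truncated at `1 / t`. -/
lemma exists_lintegral_broken_rpow_mul_min_le {a₁ a₂ N : ℝ} (ha₂ : a₂ < 0) (h₁ : 0 < a₁ + N)
    (h₂ : 0 < a₂ + N) :
    ∃ c : ℝ, 0 < c ∧ ∀ t : ℝ, 0 < t →
      ∫⁻ r in Set.Ioi 0, ENNReal.ofReal
        ((if r < 1 then r ^ (a₁ - 1) else r ^ (a₂ - 1)) * min 1 (t * r) ^ N) ≤
      ENNReal.ofReal (c * (if t < 1 then t ^ (-a₂) else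
        if a₁ ≠ 0 then t ^ max (-a₁) 0 else Real.log (1 + t))) := by
  have hN : 0 ≤ N := by linarith
  have ha₂' : 0 < -a₂ := by linarith
  have hlog2 : 0 < Real.log 2 := Real.log_pos (by norm_num)
  have split : ∀ t : ℝ, ∫⁻ r in Set.Ioi 0, ENNReal.ofReal
        ((if r < 1 then r ^ (a₁ - 1) else r ^ (a₂ - 1)) * min 1 (t * r) ^ N) ≤
      (∫⁻ r in Set.Ioc 0 1, ENNReal.ofReal (r ^ (a₁ - 1) * min 1 (t * r) ^ N)) +
      ∫⁻ r in Set.Ioi 1, ENNReal.ofReal (r ^ (a₂ - 1) * min 1 (t * r) ^ N) := by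
    intro t
    rw [← Set.Ioc_union_Ioi_eq_Ioi zero_le_one]
    refine (lintegral_union_le _ _ _).trans (add_le_add (le_of_eq ?_) (le_of_eq ?_))
    · refine setLIntegral_congr_fun measurableSet_Ioc fun r hr => ?_
      rcases hr.2.lt_or_eq with h | h
      · simp [h]
      · simp [h]
    · refine setLIntegral_congr_fun measurableSet_Ioi fun r hr => ?_
      simp [not_lt.2 (le_of_lt (Set.mem_Ioi.1 hr))]
  have high : ∀ t : ℝ, 0 < t →
      ∫⁻ r in Set.Ioi 1, ENNReal.ofReal (r ^ (a₂ - 1) * min 1 (t * r) ^ N) ≤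
        ENNReal.ofReal (1 / (-a₂)) := fun t ht => by
    simpa using (setLIntegral_rpow_mul_min_le hN ht measurableSet_Ioi
      (Set.Ioi_subset_Ioi zero_le_one)).trans (lintegral_Ioi_rpow_sub_one ha₂ one_pos).le
  have small : ∀ t : ℝ, 0 < t → t < 1 → ∫⁻ r in Set.Ioi 0, ENNReal.ofReal
        ((if r < 1 then r ^ (a₁ - 1) else r ^ (a₂ - 1)) * min 1 (t * r) ^ N) ≤
      ENNReal.ofReal ((1 / (a₁ + N) + (1 / (a₂ + N) + 1 / (-a₂))) * t ^ (-a₂)) := by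
    intro t ht ht1
    refine (split t).trans ((add_le_add
      (setLIntegral_Ioc_rpow_mul_min_le h₁ hN ht one_pos)
      ((lintegral_mono_set (Set.Ioi_subset_Ioi zero_le_one)).trans
        (lintegral_Ioi_rpow_mul_min_le ha₂ h₂ ht))).trans ?_)
    rw [← ENNReal.ofReal_add (by positivity) (by positivity)]
    refine ENNReal.ofReal_le_ofReal ?_
    have : t ^ N ≤ t ^ (-a₂) := Real.rpow_le_rpow_of_exponent_ge ht ht1.le (by linarith)
    have := mul_le_mul_of_nonneg_right this (by positivity : 0 ≤ 1 / (a₁ + N))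
    rw [Real.one_rpow]
    linarith
  have large : ∃ c : ℝ, 0 < c ∧ ∀ t : ℝ, 1 ≤ t →
      ∫⁻ r in Set.Ioc 0 1, ENNReal.ofReal (r ^ (a₁ - 1) * min 1 (t * r) ^ N) ≤
        ENNReal.ofReal (c * if a₁ ≠ 0 then t ^ max (-a₁) 0 else Real.log (1 + t)) := by
    rcases lt_trichotomy a₁ 0 with h | h | h
    · have h' : 0 < -a₁ := by linarith
      refine ⟨1 / (a₁ + N) + 1 / (-a₁), by positivity, fun t ht => ?_⟩
      rw [if_pos h.ne, max_eq_left h'.le]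
      exact (lintegral_mono_set Set.Ioc_subset_Ioi_self).trans
        (lintegral_Ioi_rpow_mul_min_le h h₁ (by linarith))
    · subst h
      rw [zero_add] at h₁
      refine ⟨1 / N / Real.log 2 + 1, by positivity, fun t ht => ?_⟩
      have ht0 : 0 < t := by linarith
      have hit : 0 < t⁻¹ := by positivity
      have hlog : Real.log 2 ≤ Real.log (1 + t) := Real.log_le_log (by norm_num) (by linarith)
      have hlogt : Real.log t ≤ Real.log (1 + t) := Real.log_le_log ht0 (by linarith)
      rw [if_neg (by simp), ← Set.Ioc_union_Ioc_eq_Ioc hit.le (inv_le_one_of_one_le₀ ht)]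
      refine (lintegral_union_le _ _ _).trans ?_
      have e := lintegral_Ioc_rpow_neg_one hit (inv_le_one_of_one_le₀ ht)
      rw [show (-1 : ℝ) = 0 - 1 by norm_num] at e
      refine (add_le_add (setLIntegral_Ioc_rpow_mul_min_le (by linarith) hN ht0 hit)
        ((setLIntegral_rpow_mul_min_le hN ht0 measurableSet_Ioc
          (Set.Ioc_subset_Ioi_self.trans (Set.Ioi_subset_Ioi hit.le))).trans e.le)).trans ?_
      rw [Real.log_inv, neg_neg, ← ENNReal.ofReal_add (by positivity) (Real.log_nonneg ht)]
      refine ENNReal.ofReal_le_ofReal ?_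
      have e1 : t ^ N * (t⁻¹ ^ (0 + N) / (0 + N)) = 1 / N := by
        rw [zero_add, Real.inv_rpow ht0.le]; field_simp
      rw [e1, add_mul, one_mul]
      refine add_le_add ?_ hlogt
      rw [div_mul_eq_mul_div, le_div_iff₀ hlog2]
      gcongr
    · refine ⟨1 / a₁, by positivity, fun t ht => ?_⟩
      rw [if_pos h.ne', max_eq_right (by linarith)]
      simpa using (setLIntegral_rpow_mul_min_le hN (by linarith : 0 < t) measurableSet_Ioc
        Set.Ioc_subset_Ioi_self).trans (lintegral_Ioc_rpow_sub_one h one_pos).le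
  obtain ⟨c, hc, hlarge⟩ := large
  have hm : 0 < min 1 (Real.log 2) := lt_min one_pos hlog2
  refine ⟨(1 / (a₁ + N) + (1 / (a₂ + N) + 1 / (-a₂))) + (c + 1 / (-a₂) / min 1 (Real.log 2)),
    by positivity, fun t ht => ?_⟩
  split_ifs with ht1 h0
  · refine (small t ht ht1).trans (ENNReal.ofReal_le_ofReal ?_)
    exact mul_le_mul_of_nonneg_right (le_add_of_nonneg_right (by positivity)) (by positivity)
  all_goals
    rw [not_lt] at ht1
    have hl := hlarge t ht1
    refine (split t).trans ((add_le_add hl (high t ht)).trans ?_)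
  · rw [if_pos h0]
    have h1 : min 1 (Real.log 2) ≤ t ^ max (-a₁) 0 :=
      (min_le_left _ _).trans (Real.one_le_rpow ht1 (le_max_right _ _))
    rw [← ENNReal.ofReal_add (by positivity) (by positivity)]
    refine ENNReal.ofReal_le_ofReal ?_
    have h2 : 1 / (-a₂) ≤ 1 / (-a₂) / min 1 (Real.log 2) * t ^ max (-a₁) 0 := by
      rw [div_mul_eq_mul_div, le_div_iff₀ hm]; gcongr
    have h3 : 0 ≤ (1 / (a₁ + N) + (1 / (a₂ + N) + 1 / (-a₂))) * t ^ max (-a₁) 0 := by positivity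
    linarith
  · rw [if_neg h0]
    have h1 : min 1 (Real.log 2) ≤ Real.log (1 + t) :=
      (min_le_right _ _).trans (Real.log_le_log (by norm_num) (by linarith))
    have h0' : 0 ≤ Real.log (1 + t) := hm.le.trans h1
    rw [← ENNReal.ofReal_add (by positivity) (by positivity)]
    refine ENNReal.ofReal_le_ofReal ?_
    have h2 : 1 / (-a₂) ≤ 1 / (-a₂) / min 1 (Real.log 2) * Real.log (1 + t) := by
      rw [div_mul_eq_mul_div, le_div_iff₀ hm]; gcongr
    have h3 : 0 ≤ (1 / (a₁ + N) + (1 / (a₂ + N) + 1 / (-a₂))) * Real.log (1 + t) := by positivity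
    linarith

lemma brokenPow_nonneg (E : ℝ × ℝ) {t : ℝ} (ht : 0 ≤ t) : 0 ≤ brokenPow E t := by
  unfold brokenPow; split_ifs <;> positivity

lemma brokenPow_pos (E : ℝ × ℝ) {t : ℝ} (ht : 0 < t) : 0 < brokenPow E t := by
  unfold brokenPow; split_ifs <;> positivity

lemma measurable_brokenPow (E : ℝ × ℝ) : Measurable (brokenPow E) :=
  Measurable.ite measurableSet_Iio (by fun_prop) (by fun_prop)

lemma brokenPow_mono {E : ℝ × ℝ} (h₁ : 0 ≤ E.1) (h₂ : 0 ≤ E.2) {s t : ℝ} (hs : 0 ≤ s)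
    (hst : s ≤ t) : brokenPow E s ≤ brokenPow E t := by
  unfold brokenPow
  split_ifs with h h' h'
  · exact Real.rpow_le_rpow hs hst h₁
  · exact (Real.rpow_le_one hs h.le h₁).trans (Real.one_le_rpow (not_lt.1 h') h₂)
  · linarith
  · exact Real.rpow_le_rpow hs hst h₂

lemma brokenPow_neg (E : ℝ × ℝ) {t : ℝ} (ht : 0 ≤ t) :
    brokenPow (-E.1, -E.2) t = (brokenPow E t)⁻¹ := by
  unfold brokenPow
  split_ifs <;> exact Real.rpow_neg ht _

/-- The growth function `C(t)` of the local uncertainty inequality, with `σ = 1 / p`. -/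
noncomputable def uncertaintyGrowth (d : ℕ) (B : ℝ × ℝ) (σ t : ℝ) : ℝ :=
  if B.1 + (d : ℝ) * (σ - 1) ≠ 0 then
    brokenPow (B.2 + (d : ℝ) * (σ - 1), max (B.1 + (d : ℝ) * (σ - 1)) 0) t
  else if t < 1 then t ^ (B.2 + (d : ℝ) * (σ - 1))
  else Real.log (1 + t) ^ (1 - σ)

lemma uncertaintyGrowth_nonneg (d : ℕ) (B : ℝ × ℝ) (σ : ℝ) {t : ℝ} (ht : 0 < t) :
    0 ≤ uncertaintyGrowth d B σ t := by
  unfold uncertaintyGrowth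
  split_ifs
  · exact brokenPow_nonneg _ ht.le
  · positivity
  · exact Real.rpow_nonneg (Real.log_nonneg (by linarith)) _

lemma min_pow_le_uncertaintyGrowth_one_mul (d : ℕ) {B : ℝ × ℝ} (h₁ : 0 ≤ B.1) (h₂ : 0 ≤ B.2) {n : ℕ}
    (hn₁ : B.1 ≤ n) (hn₂ : B.2 ≤ n) {t r : ℝ} (ht : 0 < t) (hr : 0 < r) :
    min 1 (t * r) ^ n ≤ uncertaintyGrowth d B 1 t * brokenPow B r := by
  have e : uncertaintyGrowth d B 1 t = brokenPow (B.2, B.1) t := by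
    unfold uncertaintyGrowth brokenPow
    simp only [sub_self, mul_zero, add_zero, Real.rpow_zero, max_eq_left h₁]
    split_ifs with h h' h'
    · rfl
    · rfl
    · rfl
    · rw [not_not.1 h, Real.rpow_zero]
  have hm : 0 < min 1 (t * r) := lt_min one_pos (by positivity)
  have key : ∀ b : ℝ, 0 ≤ b → b ≤ n → min 1 (t * r) ^ n ≤ t ^ b * r ^ b := fun b hb hbn => by
    rw [← Real.mul_rpow ht.le hr.le, ← Real.rpow_natCast]
    exact (Real.rpow_le_rpow_of_exponent_ge hm (min_le_left _ _) hbn).trans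
      (Real.rpow_le_rpow hm.le (min_le_right _ _) hb)
  rw [e]
  unfold brokenPow
  split_ifs with ht1 hr1 hr1
  · refine (key n n.cast_nonneg le_rfl).trans ?_
    exact mul_le_mul (Real.rpow_le_rpow_of_exponent_ge ht ht1.le hn₂)
      (Real.rpow_le_rpow_of_exponent_ge hr hr1.le hn₁) (by positivity) (by positivity)
  · exact key _ h₂ hn₂
  · exact key _ h₁ hn₁
  · exact (pow_le_one₀ hm.le (min_le_left _ _)).trans
      (one_le_mul_of_one_le_of_one_le (Real.one_le_rpow (not_lt.1 ht1) h₁)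
        (Real.one_le_rpow (not_lt.1 hr1) h₂))

/-- Polar coordinates bound for the lower integral of a nonnegative radial function. -/
lemma lintegral_ofReal_fun_norm_le {E : Type*} [NormedAddCommGroup E] [NormedSpace ℝ E]
    [FiniteDimensional ℝ E] [Nontrivial E] [MeasurableSpace E] [BorelSpace E] (μ : Measure E)
    [μ.IsAddHaarMeasure] {F : ℝ → ℝ} (hF : Measurable F) (hF0 : ∀ r, 0 ≤ r → 0 ≤ F r) {K : ℝ}
    (hK : 0 ≤ K)
    (h : ∫⁻ r in Set.Ioi 0, ENNReal.ofReal (r ^ (Module.finrank ℝ E - 1) * F r) ≤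
      ENNReal.ofReal K) :
    ∫⁻ x, ENNReal.ofReal (F ‖x‖) ∂μ ≤
      ENNReal.ofReal (Module.finrank ℝ E * μ.real (Metric.ball 0 1) * K) := by
  have hm : Measurable fun r : ℝ => r ^ (Module.finrank ℝ E - 1) * F r := by fun_prop
  have h0 : 0 ≤ᵐ[volume.restrict (Set.Ioi 0)]
      fun r : ℝ => r ^ (Module.finrank ℝ E - 1) * F r :=
    (ae_restrict_mem measurableSet_Ioi).mono fun r hr =>
      mul_nonneg (pow_nonneg (le_of_lt hr) _) (hF0 r (le_of_lt hr))
  have hi : IntegrableOn (fun r : ℝ => r ^ (Module.finrank ℝ E - 1) • F r) (Set.Ioi 0) := by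
    simp only [smul_eq_mul]
    refine ⟨hm.aestronglyMeasurable, ?_⟩
    rw [hasFiniteIntegral_iff_ofReal h0]
    exact h.trans_lt ENNReal.ofReal_lt_top
  have hi' := (integrable_fun_norm_addHaar μ).2 hi
  rw [← ofReal_integral_eq_lintegral_ofReal hi' (.of_forall fun x => hF0 _ (norm_nonneg x)),
    integral_fun_norm_addHaar]
  refine ENNReal.ofReal_le_ofReal ?_
  rw [nsmul_eq_mul, smul_eq_mul, ← mul_assoc]
  refine mul_le_mul_of_nonneg_left ?_ (by positivity)
  simp only [smul_eq_mul] at hi ⊢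
  rw [← ofReal_integral_eq_lintegral_ofReal hi h0] at h
  exact (ENNReal.ofReal_le_ofReal_iff hK).1 h

/-- The `L^{p'}` norm of the truncated inverse weight grows at most like `C(t)`. -/
lemma exists_eLpNorm_truncated_inv_brokenWeight_le
    (d : ℕ) (hd : 1 ≤ d) (p : ℝ≥0∞) (hp : 1 ≤ p) (B : ℝ × ℝ) (hB1 : 0 ≤ B.1) (hB2 : 0 ≤ B.2)
    (hpB : 1 < p → (d : ℝ) * (1 - (1/p).toReal) < B.2) (n : ℕ) (hn1 : B.1 ≤ n) (hn2 : B.2 ≤ n) :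
    ∃ c : ℝ, 0 < c ∧ ∀ t : ℝ, 0 < t →
      eLpNorm (fun ξ : EuclideanSpace ℝ (Fin d) => (brokenWeight B ξ)⁻¹ * min 1 (t * ‖ξ‖) ^ n)
        (1 - p⁻¹)⁻¹ volume ≤ ENNReal.ofReal (c * uncertaintyGrowth d B (1/p).toReal t) := by
  have : NeZero d := ⟨by omega⟩
  rcases hp.eq_or_lt with rfl | hp1
  · refine ⟨1, one_pos, fun t ht => ?_⟩
    simp only [inv_one, tsub_self, ENNReal.inv_zero, eLpNorm_exponent_top, div_one,
      ENNReal.toReal_one, one_mul]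
    refine eLpNormEssSup_le_of_ae_bound ?_
    filter_upwards [Measure.ae_ne volume (0 : EuclideanSpace ℝ (Fin d))] with ξ hξ
    have hr : 0 < ‖ξ‖ := norm_pos_iff.2 hξ
    have hw : 0 < brokenWeight B ξ := brokenPow_pos B hr
    have hm : 0 < min 1 (t * ‖ξ‖) := lt_min one_pos (by positivity)
    rw [Real.norm_of_nonneg (by positivity), inv_mul_le_iff₀ hw,
      mul_comm (brokenWeight B ξ)]
    exact min_pow_le_uncertaintyGrowth_one_mul d hB1 hB2 hn1 hn2 ht hr
  · have hB := hpB hp1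
    have hinv : p⁻¹ < 1 := ENNReal.inv_lt_one.2 hp1
    set σ := (1 / p).toReal with hσ
    have hσ' : σ = p⁻¹.toReal := by rw [hσ, one_div]
    have hs : 0 < 1 - σ := by
      have := (ENNReal.toReal_lt_toReal hinv.ne_top ENNReal.one_ne_top).2 hinv
      rw [ENNReal.toReal_one] at this
      linarith
    set q := (1 - p⁻¹)⁻¹ with hq
    have hQ : q.toReal = (1 - σ)⁻¹ := by
      rw [hq, ENNReal.toReal_inv, ENNReal.toReal_sub_of_le hinv.le ENNReal.one_ne_top, hσ',
        ENNReal.toReal_one]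
    set Q := (1 - σ)⁻¹ with hQdef
    have hQ0 : 0 < Q := inv_pos.2 hs
    have hQs : Q * (1 - σ) = 1 := inv_mul_cancel₀ hs.ne'
    have hq0 : q ≠ 0 := by rintro h; rw [h] at hQ; simp at hQ; linarith
    have hqt : q ≠ ∞ := by rintro h; rw [h] at hQ; simp at hQ; linarith
    have hd0 : (0 : ℝ) < d := by exact_mod_cast hd
    have ea : ∀ b : ℝ, -((d : ℝ) - Q * b) = Q * (b + d * (σ - 1)) := fun b => by
      linear_combination (d : ℝ) * hQs
    have hN : ∀ b : ℝ, b ≤ n → 0 < ((d : ℝ) - Q * b) + n * Q := fun b hb => by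
      have := mul_le_mul_of_nonneg_left hb hQ0.le
      linarith
    have ha2 : (d : ℝ) - Q * B.2 < 0 := by
      have := mul_lt_mul_of_pos_left hB hQ0
      have e := ea B.2
      nlinarith
    obtain ⟨c, hc, H⟩ := exists_lintegral_broken_rpow_mul_min_le ha2 (hN _ hn1) (hN _ hn2)
    set κ := (Module.finrank ℝ (EuclideanSpace ℝ (Fin d)) : ℝ) *
      (volume : Measure (EuclideanSpace ℝ (Fin d))).real (Metric.ball 0 1) with hκ
    have hκ0 : 0 ≤ κ := by positivity
    refine ⟨(κ * c) ^ (1 - σ) + 1, by positivity, fun t ht => ?_⟩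
    have hC := uncertaintyGrowth_nonneg d B σ ht
    have hD : (if t < 1 then t ^ (-((d : ℝ) - Q * B.2)) else
        if (d : ℝ) - Q * B.1 ≠ 0 then t ^ max (-((d : ℝ) - Q * B.1)) 0 else Real.log (1 + t)) =
        uncertaintyGrowth d B σ t ^ Q := by
      have h0 : (d : ℝ) - Q * B.1 ≠ 0 ↔ B.1 + d * (σ - 1) ≠ 0 := by
        rw [← neg_ne_zero, ea]; simp [hQ0.ne']
      simp only [ea, h0]
      unfold uncertaintyGrowth brokenPow
      split_ifs with h1 h2 h2
      · rw [← Real.rpow_mul ht.le, mul_comm]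
      · rw [← Real.rpow_mul ht.le, mul_comm]
      · rw [← Real.rpow_mul ht.le, max_mul_of_nonneg _ _ hQ0.le, zero_mul, mul_comm]
      · rw [← Real.rpow_mul (Real.log_nonneg (by linarith)), mul_comm (1 - σ), hQs, Real.rpow_one]
    have Ht := H t ht
    rw [hD] at Ht
    have hG0 : ∀ r : ℝ, 0 ≤ r → 0 ≤ (brokenPow B r)⁻¹ * min 1 (t * r) ^ n := fun r hr =>
      mul_nonneg (inv_nonneg.2 (brokenPow_nonneg B hr))
        (pow_nonneg (le_min zero_le_one (by positivity)) n)
    have hGm : Measurable fun r : ℝ => ((brokenPow B r)⁻¹ * min 1 (t * r) ^ n) ^ Q := by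
      have := measurable_brokenPow B
      fun_prop
    have key := lintegral_ofReal_fun_norm_le (volume : Measure (EuclideanSpace ℝ (Fin d))) hGm
      (fun r hr => Real.rpow_nonneg (hG0 r hr) Q)
      (K := c * uncertaintyGrowth d B σ t ^ Q) (by positivity) (by
        refine (le_of_eq (setLIntegral_congr_fun measurableSet_Ioi fun r hr => ?_)).trans Ht
        have hr0 : 0 < r := hr
        have hm : 0 < min 1 (t * r) := lt_min one_pos (by positivity)
        have e : ∀ b : ℝ, r ^ ((d : ℝ) - Q * b - 1) = r ^ (d - 1 : ℕ) * ((r ^ b)⁻¹) ^ Q := by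
          intro b
          rw [← Real.rpow_natCast, Nat.cast_sub hd, ← Real.rpow_neg hr0.le, ← Real.rpow_mul hr0.le,
            ← Real.rpow_add hr0]
          congr 1
          push_cast; ring
        have e2 : min 1 (t * r) ^ ((n : ℝ) * Q) = (min 1 (t * r) ^ n) ^ Q := by
          rw [Real.rpow_mul hm.le, Real.rpow_natCast]
        simp only [finrank_euclideanSpace, Fintype.card_fin]
        rw [Real.mul_rpow (inv_nonneg.2 (brokenPow_nonneg B hr0.le)) (by positivity), e2, e, e]
        unfold brokenPow
        congr 1
        split_ifs <;> ring)
    rw [eLpNorm_eq_lintegral_rpow_enorm_toReal hq0 hqt, hQ]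
    have e : ∀ x : EuclideanSpace ℝ (Fin d),
        ‖(brokenWeight B x)⁻¹ * min 1 (t * ‖x‖) ^ n‖ₑ ^ Q =
        ENNReal.ofReal (((brokenPow B ‖x‖)⁻¹ * min 1 (t * ‖x‖) ^ n) ^ Q) := fun x => by
      have h0 := hG0 ‖x‖ (norm_nonneg x)
      rw [← ENNReal.ofReal_rpow_of_nonneg h0 hQ0.le, ← Real.enorm_of_nonneg h0]
      rfl
    simp only [e]
    have hQi : 1 / Q = 1 - σ := by rw [hQdef, one_div, inv_inv]
    rw [hQi]
    refine (ENNReal.rpow_le_rpow key hs.le).trans ?_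
    rw [ENNReal.ofReal_rpow_of_nonneg (by positivity) hs.le, ← hκ, ← mul_assoc,
      Real.mul_rpow (by positivity) (by positivity), ← Real.rpow_mul hC, hQs, Real.rpow_one]
    refine ENNReal.ofReal_le_ofReal (mul_le_mul_of_nonneg_right ?_ hC)
    linarith

lemma exp_fourier_add_nsmul {V : Type*} [NormedAddCommGroup V] [InnerProductSpace ℝ V]
    (ξ x h : V) (k : ℕ) :
    Complex.exp ((2 * Real.pi * inner ℝ ξ (x + k • h) : ℝ) * Complex.I) =
      Complex.exp ((2 * Real.pi * inner ℝ ξ x : ℝ) * Complex.I) *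
        Complex.exp ((2 * Real.pi * inner ℝ ξ h : ℝ) * Complex.I) ^ k := by
  rw [← Complex.exp_nat_mul, ← Complex.exp_add, inner_add_right, ← Nat.cast_smul_eq_nsmul ℝ k h,
    inner_smul_right]
  push_cast
  ring_nf

lemma norm_one_sub_exp_fourier_le {V : Type*} [NormedAddCommGroup V] [InnerProductSpace ℝ V]
    {t : ℝ} {h : V} (hh : ‖h‖ = 2 * t) (ξ : V) :
    ‖1 - Complex.exp ((2 * Real.pi * inner ℝ ξ h : ℝ) * Complex.I)‖ ≤
      4 * Real.pi * min 1 (t * ‖ξ‖) := by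
  have hπ := Real.pi_gt_three
  rw [mul_min_of_nonneg _ _ (by positivity)]
  refine le_min ?_ ?_
  · refine (norm_sub_le _ _).trans ?_
    rw [norm_one, Complex.norm_exp_ofReal_mul_I]
    linarith
  · rw [norm_sub_rev, mul_comm _ Complex.I]
    refine Real.norm_exp_I_mul_ofReal_sub_one_le.trans ?_
    rw [norm_mul, Real.norm_of_nonneg (by positivity)]
    have := norm_inner_le_norm (𝕜 := ℝ) ξ h
    rw [hh] at this
    have := mul_le_mul_of_nonneg_left this (by positivity : 0 ≤ 2 * Real.pi)
    linarith

/-- Fourier representation of the `n`-th order finite difference of a Schwartz function. -/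
lemma SchwartzMap.sum_neg_one_pow_mul_choose_mul_eq_integral {V : Type*} [NormedAddCommGroup V]
    [InnerProductSpace ℝ V] [FiniteDimensional ℝ V] [MeasurableSpace V] [BorelSpace V]
    (f : SchwartzMap V ℂ) (x h : V) (n : ℕ) :
    ∑ k ∈ Finset.range (n + 1), (-1 : ℂ) ^ k * (n.choose k : ℂ) * f (x + k • h) =
      ∫ ξ, Complex.exp ((2 * Real.pi * inner ℝ ξ x : ℝ) * Complex.I) *
        (1 - Complex.exp ((2 * Real.pi * inner ℝ ξ h : ℝ) * Complex.I)) ^ n * 𝓕 (⇑f) ξ := by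
  have hF : Integrable (𝓕 (⇑f)) := (𝓕 f).integrable
  have rep : ∀ y, f y =
      ∫ ξ, Complex.exp ((2 * Real.pi * inner ℝ ξ y : ℝ) * Complex.I) * 𝓕 (⇑f) ξ := fun y => by
    conv_lhs => rw [← f.continuous.fourierInv_fourier_eq f.integrable hF]
    rw [Real.fourierInv_eq']
    rfl
  have int : ∀ y, Integrable fun ξ =>
      Complex.exp ((2 * Real.pi * inner ℝ ξ y : ℝ) * Complex.I) * 𝓕 (⇑f) ξ := fun y => by
    refine hF.bdd_mul (c := 1) (Continuous.aestronglyMeasurable (by fun_prop)) ?_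
    exact .of_forall fun ξ => (Complex.norm_exp_ofReal_mul_I _).le
  simp_rw [rep, ← integral_const_mul]
  rw [← integral_finsetSum _ fun k _ => (int _).const_mul _]
  refine integral_congr_ae (.of_forall fun ξ => ?_)
  simp only [exp_fourier_add_nsmul]
  rw [sub_eq_neg_add, add_pow, Finset.mul_sum, Finset.sum_mul]
  refine Finset.sum_congr rfl fun k _ => ?_
  rw [neg_pow, one_pow]
  ring

lemma SchwartzMap.enorm_sum_choose_le_lintegral {V : Type*} [NormedAddCommGroup V]
    [InnerProductSpace ℝ V] [FiniteDimensional ℝ V] [MeasurableSpace V] [BorelSpace V]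
    (f : SchwartzMap V ℂ) (x : V) {h : V} (n : ℕ) {t : ℝ} (ht : 0 < t) (hh : ‖h‖ = 2 * t) :
    ‖∑ k ∈ Finset.range (n + 1), (-1 : ℂ) ^ k * (n.choose k : ℂ) * f (x + k • h)‖ₑ ≤
      ENNReal.ofReal ((4 * Real.pi) ^ n) *
        ∫⁻ ξ, ENNReal.ofReal (min 1 (t * ‖ξ‖) ^ n) * ‖𝓕 (⇑f) ξ‖ₑ := by
  rw [f.sum_neg_one_pow_mul_choose_mul_eq_integral,
    ← lintegral_const_mul' _ _ ENNReal.ofReal_ne_top]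
  refine (enorm_integral_le_lintegral_enorm _).trans (lintegral_mono fun ξ => ?_)
  have hm : 0 ≤ min 1 (t * ‖ξ‖) := le_min zero_le_one (by positivity)
  rw [← mul_assoc, ← ENNReal.ofReal_mul (by positivity), ← mul_pow, enorm_mul]
  gcongr
  rw [← ofReal_norm, norm_mul, Complex.norm_exp_ofReal_mul_I, one_mul, norm_pow]
  gcongr
  exact norm_one_sub_exp_fourier_le hh ξ

/-- Hölder's inequality against the weight `w` and its inverse. -/
lemma lintegral_ofReal_mul_enorm_le_eLpNorm_mul_eLpNorm {α E : Type*} [MeasurableSpace α]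
    {μ : Measure α} [NormedAddCommGroup E] {p q : ℝ≥0∞} [ENNReal.HolderConjugate p q] {w g : α → ℝ}
    {F : α → E} (hw : AEStronglyMeasurable w μ) (hg : AEStronglyMeasurable g μ)
    (hF : AEStronglyMeasurable F μ) (hw0 : ∀ᵐ x ∂μ, 0 < w x) (hg0 : ∀ x, 0 ≤ g x) :
    ∫⁻ x, ENNReal.ofReal (g x) * ‖F x‖ₑ ∂μ ≤
      eLpNorm (fun x => w x * ‖F x‖) p μ * eLpNorm (fun x => (w x)⁻¹ * g x) q μ := by
  have hH := eLpNorm_smul_le_mul_eLpNorm (p := p) (q := q) (r := 1) (μ := μ)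
    (f := fun x => (w x)⁻¹ * g x) (φ := fun x => w x * ‖F x‖)
    (hw.aemeasurable.inv.aestronglyMeasurable.mul hg) (hw.mul hF.norm)
  refine le_trans (le_of_eq ?_) hH
  rw [eLpNorm_one_eq_lintegral_enorm]
  refine lintegral_congr_ae (hw0.mono fun x hx => ?_)
  have e : ((fun x => w x * ‖F x‖) • fun x => (w x)⁻¹ * g x) x = g x * ‖F x‖ := by
    simp only [Pi.smul_apply', smul_eq_mul]
    field_simp
  simp only [e]
  rw [enorm_mul, enorm_norm, Real.enorm_of_nonneg (hg0 x)]

lemma norm_le_norm_add_nsmul {V : Type*} [NormedAddCommGroup V] [NormedSpace ℝ V] {x h : V}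
    {t : ℝ} (hx : ‖x‖ ≤ t) (hh : ‖h‖ = 2 * t) {k : ℕ} (hk : 1 ≤ k) : t ≤ ‖x + k • h‖ := by
  have ht : 0 ≤ t := (norm_nonneg x).trans hx
  have h1 : ‖k • h‖ = k * (2 * t) := by rw [← Nat.cast_smul_eq_nsmul ℝ, norm_smul, hh]; simp
  have h2 := norm_sub_le (x + k • h) x
  rw [add_sub_cancel_left, h1] at h2
  have h3 : (1 : ℝ) ≤ k := by exact_mod_cast hk
  nlinarith

lemma measurable_brokenWeight {d : ℕ} (A : ℝ × ℝ) :
    Measurable (brokenWeight A : EuclideanSpace ℝ (Fin d) → ℝ) :=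
  (measurable_brokenPow A).comp measurable_norm

/-- Away from the ball of radius `t`, `f` is controlled by `t^{-A} ‖x^A f‖_∞`. -/
lemma ae_enorm_le_brokenPow_neg_mul {d : ℕ} {A : ℝ × ℝ} (hA1 : 0 ≤ A.1) (hA2 : 0 ≤ A.2)
    (f : EuclideanSpace ℝ (Fin d) → ℂ) {t : ℝ} (ht : 0 < t) :
    ∀ᵐ y, t ≤ ‖y‖ → ‖f y‖ₑ ≤ ENNReal.ofReal (brokenPow (-A.1, -A.2) t) *
      eLpNorm (fun x => brokenWeight A x * ‖f x‖) ∞ volume := by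
  filter_upwards [ae_le_eLpNormEssSup (f := fun x => brokenWeight A x * ‖f x‖) (μ := volume)]
    with y hy hty
  rw [eLpNorm_exponent_top]
  refine le_trans ?_ (mul_le_mul_right hy _)
  have hw0 : 0 ≤ brokenWeight A y := brokenPow_nonneg A (norm_nonneg y)
  have hp := brokenPow_pos A ht
  have hw : brokenPow A t ≤ brokenWeight A y := brokenPow_mono hA1 hA2 ht.le hty
  rw [Real.enorm_of_nonneg (mul_nonneg hw0 (norm_nonneg _)), brokenPow_neg A ht.le,
    ← ENNReal.ofReal_mul (by positivity), ← ofReal_norm]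
  refine ENNReal.ofReal_le_ofReal ?_
  rw [← mul_assoc]
  refine le_mul_of_one_le_left (norm_nonneg _) ?_
  rwa [inv_mul_eq_div, one_le_div₀ hp]

/-- Lemma 3.2: the sup-norm local uncertainty estimate
`‖f‖_∞ ≲ C(t) ‖ξ^B f̂‖_p + t^{−A} ‖x^A f‖_∞`. -/
theorem local_uncertainty_sup_norm
    (d : ℕ) (hd : 1 ≤ d) (p : ℝ≥0∞) (hp : 1 ≤ p)
    (A B : ℝ × ℝ) (hA1 : 0 ≤ A.1) (hA2 : 0 ≤ A.2) (hB1 : 0 ≤ B.1) (hB2 : 0 ≤ B.2)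
    (hpB : 1 < p → (d : ℝ) * (1 - (1/p).toReal) < B.2) :
    ∃ c : ℝ, 0 < c ∧
      ∀ f : SchwartzMap (EuclideanSpace ℝ (Fin d)) ℂ, ∀ t : ℝ, 0 < t →
        eLpNorm (⇑f) ∞ volume ≤ ENNReal.ofReal c *
          (ENNReal.ofReal
              (if B.1 + (d : ℝ) * ((1/p).toReal - 1) ≠ 0 then
                brokenPow
                  (B.2 + (d : ℝ) * ((1/p).toReal - 1),
                    max (B.1 + (d : ℝ) * ((1/p).toReal - 1)) 0) t
              else if t < 1 then t ^ (B.2 + (d : ℝ) * ((1/p).toReal - 1))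
              else Real.log (1 + t) ^ (1 - (1/p).toReal)) *
              eLpNorm (fun ξ => brokenWeight B ξ * ‖𝓕 (⇑f) ξ‖) p volume +
            ENNReal.ofReal (brokenPow (-A.1, -A.2) t) *
              eLpNorm (fun x => brokenWeight A x * ‖f x‖) ∞ volume) := by
  have : NeZero d := ⟨by omega⟩
  obtain ⟨n, hn⟩ := exists_nat_ge (B.1 + B.2)
  obtain ⟨c, hc, hker⟩ := exists_eLpNorm_truncated_inv_brokenWeight_le d hd p hp B hB1 hB2 hpB n
    (by linarith) (by linarith)
  have : ENNReal.HolderConjugate p (1 - p⁻¹)⁻¹ := ENNReal.HolderConjugate.inv_one_sub_inv' hp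
  refine ⟨(4 * Real.pi) ^ n * c + 2 ^ n, by positivity, fun f t ht => ?_⟩
  set M := eLpNorm (fun x => brokenWeight A x * ‖f x‖) ∞ volume
  set G := eLpNorm (fun ξ => brokenWeight B ξ * ‖𝓕 (⇑f) ξ‖) p volume
  set S := ENNReal.ofReal (brokenPow (-A.1, -A.2) t) * M
  change _ ≤ _ * (ENNReal.ofReal (uncertaintyGrowth d B (1/p).toReal t) * G + S)
  set C := uncertaintyGrowth d B (1/p).toReal t
  have hC : 0 ≤ C := uncertaintyGrowth_nonneg d B _ ht
  have hfar : ∀ᵐ y, t ≤ ‖y‖ → ‖f y‖ₑ ≤ S := ae_enorm_le_brokenPow_neg_mul hA1 hA2 f ht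
  obtain ⟨h, hh⟩ : ∃ h : EuclideanSpace ℝ (Fin d), ‖h‖ = 2 * t :=
    exists_norm_eq _ (by positivity)
  have hshift : ∀ᵐ x, ∀ k : ℕ, t ≤ ‖x + k • h‖ → ‖f (x + k • h)‖ₑ ≤ S :=
    ae_all_iff.2 fun k =>
      (measurePreserving_add_right volume (k • h)).quasiMeasurePreserving.ae hfar
  have hint : ENNReal.ofReal ((4 * Real.pi) ^ n) *
      ∫⁻ ξ : EuclideanSpace ℝ (Fin d), ENNReal.ofReal (min 1 (t * ‖ξ‖) ^ n) * ‖𝓕 (⇑f) ξ‖ₑ ≤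
      ENNReal.ofReal ((4 * Real.pi) ^ n * c) * (ENNReal.ofReal C * G) := by
    have hF : AEStronglyMeasurable (𝓕 (⇑f)) volume := (𝓕 f).continuous.aestronglyMeasurable
    have := lintegral_ofReal_mul_enorm_le_eLpNorm_mul_eLpNorm (p := p) (q := (1 - p⁻¹)⁻¹)
      (measurable_brokenWeight (d := d) B).aestronglyMeasurable
      (g := fun ξ => min 1 (t * ‖ξ‖) ^ n)
      (Continuous.aestronglyMeasurable (by fun_prop)) hF
      ((Measure.ae_ne volume (0 : EuclideanSpace ℝ (Fin d))).mono fun ξ hξ =>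
        brokenPow_pos B (norm_pos_iff.2 hξ))
      (fun ξ => pow_nonneg (le_min zero_le_one (by positivity)) n)
    rw [ENNReal.ofReal_mul (by positivity), mul_assoc]
    refine mul_le_mul_right (this.trans ((mul_le_mul_right (hker t ht) _).trans (le_of_eq ?_))) _
    rw [ENNReal.ofReal_mul hc.le]
    ring
  rw [eLpNorm_exponent_top]
  refine essSup_le_of_ae_le _ ?_
  filter_upwards [hfar, hshift] with x hx hxk
  rw [ENNReal.ofReal_add (by positivity) (by positivity), add_mul, mul_add, mul_add]
  rcases le_total t ‖x‖ with htx | htx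
  · refine (hx htx).trans (le_trans ?_ (le_add_left le_add_self))
    refine le_mul_of_one_le_left' ?_
    rw [← ENNReal.ofReal_one]
    exact ENNReal.ofReal_le_ofReal (one_le_pow₀ (by norm_num))
  · have hsum := f.enorm_sum_choose_le_lintegral x n ht hh
    rw [Finset.sum_range_succ'] at hsum
    simp only [pow_zero, Nat.choose_zero_right, Nat.cast_one, one_mul, zero_smul, add_zero] at hsum
    set T := ∑ k ∈ Finset.range n,
      (-1 : ℂ) ^ (k + 1) * (n.choose (k + 1) : ℂ) * f (x + (k + 1) • h)
    have hTS : ‖T‖ₑ ≤ ENNReal.ofReal (2 ^ n) * S := by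
      refine (enorm_sum_le _ _).trans ?_
      have : ∀ k ∈ Finset.range n,
          ‖(-1 : ℂ) ^ (k + 1) * (n.choose (k + 1) : ℂ) * f (x + (k + 1) • h)‖ₑ ≤
          (n.choose (k + 1) : ℝ≥0∞) * S := fun k _ => by
        rw [enorm_mul, enorm_mul, enorm_pow, enorm_neg, enorm_one, one_pow, one_mul]
        gcongr
        · rw [← ofReal_norm, Complex.norm_natCast, ENNReal.ofReal_natCast]
        · exact hxk (k + 1) (norm_le_norm_add_nsmul htx hh (by omega))
      refine (Finset.sum_le_sum this).trans ?_
      rw [← Finset.sum_mul]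
      refine mul_le_mul_left ?_ _
      have e : ENNReal.ofReal (2 ^ n) = ((2 ^ n : ℕ) : ℝ≥0∞) := by
        rw [← ENNReal.ofReal_natCast]; norm_num
      rw [e, ← Nat.cast_sum, Nat.cast_le, ← Nat.sum_range_choose, Finset.sum_range_succ']
      exact Nat.le_add_right _ _
    calc ‖f x‖ₑ = ‖(T + f x) - T‖ₑ := by rw [add_sub_cancel_left]
      _ ≤ ‖T + f x‖ₑ + ‖T‖ₑ := enorm_sub_le
      _ ≤ ENNReal.ofReal ((4 * Real.pi) ^ n * c) * (ENNReal.ofReal C * G) +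
          ENNReal.ofReal (2 ^ n) * S := add_le_add (hsum.trans hint) hTS
      _ ≤ _ := add_le_add le_self_add le_add_self
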